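/- arXiv:2312.02817 — 7 statements merged into one kernel-verified Lean document; each statement's English description precedes it below -/
import Mathlib

section
/- Let n ≥ 1, let H : ℝ → Matrix (Fin n) (Fin n) ℂ be continuous, let U be a propagator for H, let G : ℝ → ℂ be differentiable, and let y₀ ∈ ℂⁿ. Define w : ℝ × ℝ → ℂⁿ by w(t,s) := G(s−t) • (U(s, s−t)·y₀). Then w(0,s) = G(s) • y₀ for all s, and for all t, s ∈ ℝ the partial derivatives ∂w/∂t and ∂w/∂s exist and satisfy ∂w/∂t (t,s) + ∂w/∂s (t,s) = −i • (H(s)·w(t,s)). (This is the autonomous transport-equation reformulation of the non-autonomous system dy/dt = −i H(t) y.) -/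
open Matrix

attribute [local instance] Matrix.linftyOpNormedAddCommGroup Matrix.linftyOpNormedRing
  Matrix.linftyOpNormedAlgebra

/-- the autonomous transport-equation reformulation `∂w/∂t + ∂w/∂s = −i H(s) w`
of the non-autonomous system `dy/dt = −i H(t) y`, where `w(t,s) = G(s−t) • U(s,s−t) y₀`. -/
theorem transport_reformulation (n : ℕ) (hn : 1 ≤ n)
    (H : ℝ → Matrix (Fin n) (Fin n) ℂ) (hH : Continuous H)
    (U : ℝ → ℝ → Matrix (Fin n) (Fin n) ℂ)
    (hU1 : ∀ t, U t t = 1)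
    (hU2 : ∀ s t, HasDerivAt (fun τ => U τ s) ((-Complex.I) • (H t * U t s)) t)
    (hU3 : ∀ t s, HasDerivAt (fun σ => U t σ) (Complex.I • (U t s * H s)) s)
    (hU4 : ∀ t r s, U t s = U t r * U r s)
    (G : ℝ → ℂ) (hG : Differentiable ℝ G)
    (y₀ : Fin n → ℂ)
    (w : ℝ → ℝ → Fin n → ℂ)
    (hw : ∀ t s, w t s = G (s - t) • ((U s (s - t)).mulVec y₀)) :
    (∀ s, w 0 s = G s • y₀) ∧
      ∀ t s, ∃ wt ws : Fin n → ℂ,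
        HasDerivAt (fun τ => w τ s) wt t ∧
        HasDerivAt (fun σ => w t σ) ws s ∧
        wt + ws = (-Complex.I) • ((H s).mulVec (w t s)) := by
  let L : Matrix (Fin n) (Fin n) ℂ →ₗ[ℝ] (Fin n → ℂ) :=
    { toFun := fun M => M.mulVec y₀
      map_add' := fun A B => Matrix.add_mulVec A B y₀
      map_smul' := fun c A => Matrix.smul_mulVec c A y₀ }
  have hL : ∀ (f : ℝ → Matrix (Fin n) (Fin n) ℂ) (f' : Matrix (Fin n) (Fin n) ℂ) (x : ℝ),
      HasDerivAt f f' x → HasDerivAt (fun τ => (f τ).mulVec y₀) (f'.mulVec y₀) x := by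
    intro f f' x hf
    exact (LinearMap.toContinuousLinearMap L).hasFDerivAt.comp_hasDerivAt x hf
  refine ⟨fun s => by simp [hw, hU1], fun t s => ?_⟩
  have hGd := (hG (s - t)).hasDerivAt
  have ht : HasDerivAt (fun τ : ℝ => s - τ) (-1) t := by
    simpa using (hasDerivAt_id t).const_sub s
  have hs : HasDerivAt (fun σ : ℝ => σ - t) 1 s := by
    simpa using (hasDerivAt_id s).sub_const t
  have h1 := (hGd.scomp t ht).smul (hL _ _ _ ((hU3 s (s - t)).scomp t ht))
  have h2 := (hGd.scomp s hs).smul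
    (hL _ _ _ ((hU2 0 s).mul ((hU3 0 (s - t)).scomp s hs)))
  refine ⟨_, _, h1.congr_of_eventuallyEq (.of_forall fun τ => ?_),
    h2.congr_of_eventuallyEq (.of_forall fun σ => ?_), ?_⟩
  · simp [hw]
  · simp [hw, hU4 σ 0 (σ - t)]
  · have e := (hU4 s 0 (s - t)).symm
    simp only [Function.comp_apply, one_smul, neg_smul, smul_mul_assoc, mul_smul_comm,
      Matrix.mul_assoc, e, Pi.mul_apply, hw]
    simp only [← Matrix.mul_assoc, e]
    simp only [Matrix.mul_assoc, e, Matrix.add_mulVec, Matrix.neg_mulVec, Matrix.smul_mulVec,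
      Matrix.mulVec_smul, ← Matrix.mulVec_mulVec, smul_add, smul_neg]
    have e' : U s 0 *ᵥ U 0 (s - t) *ᵥ y₀ = U s (s - t) *ᵥ y₀ := by
      rw [Matrix.mulVec_mulVec, e]
    rw [e', smul_comm (G (s - t)) Complex.I ((H s) *ᵥ _)]
    abel
end

section
/- Let n ≥ 1, let H : ℝ → Matrix (Fin n) (Fin n) ℂ be continuous, and fix s ∈ ℝ. Then there exists a differentiable map Φ : ℝ → Matrix (Fin n) (Fin n) ℂ such that Φ(s) = 1 and Φ'(t) = −i • (H(t)·Φ(t)) for all t ∈ ℝ, and moreover any two differentiable maps satisfying both of these conditions are equal. (Existence and uniqueness of the time-ordered evolution operator t ↦ U_{t,s} as the solution of its defining linear initial-value problem.) -/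
/-- The terms of the Dyson series. -/
noncomputable def dysonTerm {E : Type*} [NormedRing E] [NormedAlgebra ℝ E]
    (A : ℝ → E) (s : ℝ) : ℕ → ℝ → E
  | 0 => fun _ => 1
  | k + 1 => fun t => ∫ τ in s..t, A τ * dysonTerm A s k τ

theorem dysonTerm_continuous {E : Type*} [NormedRing E] [NormedAlgebra ℝ E] [CompleteSpace E]
    (A : ℝ → E) (hA : Continuous A) (s : ℝ) (k : ℕ) : Continuous (dysonTerm A s k) := by
  induction k with
  | zero => exact continuous_const
  | succ k ih =>
    exact intervalIntegral.continuous_primitive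
      (fun a b => (hA.mul ih).intervalIntegrable a b) s

theorem dysonTerm_hasDerivAt {E : Type*} [NormedRing E] [NormedAlgebra ℝ E] [CompleteSpace E]
    (A : ℝ → E) (hA : Continuous A) (s : ℝ) (k : ℕ) (t : ℝ) :
    HasDerivAt (dysonTerm A s (k + 1)) (A t * dysonTerm A s k t) t :=
  ((hA.mul (dysonTerm_continuous A hA s k)).integral_hasStrictDerivAt s t).hasDerivAt

theorem dysonTerm_bound {E : Type*} [NormedRing E] [NormedAlgebra ℝ E] [CompleteSpace E]
    (A : ℝ → E) (s R C : ℝ) (hC : 0 ≤ C)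
    (hb : ∀ t ∈ Set.Icc (s - R) (s + R), ‖A t‖ ≤ C) (k : ℕ) :
    ∀ t ∈ Set.Icc (s - R) (s + R),
      ‖dysonTerm A s k t‖ ≤ ‖(1 : E)‖ * (C ^ k / (k.factorial : ℝ)) * |t - s| ^ k := by
  induction k with
  | zero => intro t _; simp [dysonTerm]
  | succ k ih =>
    intro t ht
    have hs : s ∈ Set.Icc (s - R) (s + R) := by
      constructor <;> linarith [ht.1, ht.2]
    set c : ℝ := C * (‖(1 : E)‖ * (C ^ k / (k.factorial : ℝ))) with hc
    have h1 : ‖dysonTerm A s (k + 1) t‖ ≤ ∫ τ in Set.uIoc s t, c * |τ - s| ^ k := by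
      change ‖∫ τ in s..t, A τ * dysonTerm A s k τ‖ ≤ _
      rw [intervalIntegral.norm_intervalIntegral_eq]
      apply MeasureTheory.norm_integral_le_of_norm_le (Continuous.integrableOn_uIoc (by fun_prop))
      apply (MeasureTheory.ae_restrict_mem measurableSet_Ioc).mono
      intro τ hτ
      have hτ' : τ ∈ Set.Icc (s - R) (s + R) :=
        (Set.uIoc_subset_uIcc.trans (Set.uIcc_subset_Icc hs ht)) hτ
      calc _ ≤ ‖A τ‖ * ‖dysonTerm A s k τ‖ := norm_mul_le _ _
        _ ≤ C * (‖(1 : E)‖ * (C ^ k / (k.factorial : ℝ)) * |τ - s| ^ k) :=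
          mul_le_mul (hb τ hτ') (ih τ hτ') (norm_nonneg _) hC
        _ = _ := by rw [hc]; ring
    refine h1.trans (le_of_eq ?_)
    rw [MeasureTheory.integral_const_mul, integral_pow_abs_sub_uIoc, hc, Nat.factorial_succ]
    push_cast
    field_simp
    ring

theorem dyson_exists {E : Type*} [NormedRing E] [NormedAlgebra ℝ E] [CompleteSpace E]
    (A : ℝ → E) (hA : Continuous A) (s : ℝ) :
    ∃ Φ : ℝ → E, Φ s = 1 ∧ ∀ t, HasDerivAt Φ (A t * Φ t) t := by
  refine ⟨fun t => ∑' k, dysonTerm A s k t, ?_, ?_⟩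
  · change ∑' k, dysonTerm A s k s = 1
    rw [tsum_eq_single 0]
    · rfl
    · intro k hk
      obtain ⟨m, rfl⟩ := Nat.exists_eq_succ_of_ne_zero hk
      simp [dysonTerm]
  · intro t
    set R : ℝ := |t - s| + 1 with hR
    have hR0 : 0 < R := by positivity
    obtain ⟨C, hCb⟩ := (isCompact_Icc (a := s - R) (b := s + R)).exists_bound_of_continuousOn
      hA.continuousOn
    have hC : 0 ≤ C := (norm_nonneg _).trans (hCb s ⟨by linarith, by linarith⟩)
    have hbd : ∀ k, ∀ y ∈ Set.Ioo (s - R) (s + R),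
        ‖dysonTerm A s k y‖ ≤ ‖(1 : E)‖ * ((C * R) ^ k / (k.factorial : ℝ)) := by
      intro k y hy
      refine (dysonTerm_bound A s R C hC hCb k y (Set.Ioo_subset_Icc_self hy)).trans ?_
      have : |y - s| ≤ R := abs_le.2 ⟨by linarith [hy.1], by linarith [hy.2]⟩
      calc _ ≤ ‖(1 : E)‖ * (C ^ k / (k.factorial : ℝ)) * R ^ k := by gcongr
        _ = _ := by rw [mul_pow]; ring
    have hsum : Summable fun k : ℕ => ‖(1 : E)‖ * ((C * R) ^ k / (k.factorial : ℝ)) :=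
      (Real.summable_pow_div_factorial (C * R)).mul_left _
    let g' : ℕ → ℝ → E := fun k y => match k with
      | 0 => 0
      | k + 1 => A y * dysonTerm A s k y
    let u : ℕ → ℝ := fun k => match k with
      | 0 => 0
      | k + 1 => C * (‖(1 : E)‖ * ((C * R) ^ k / (k.factorial : ℝ)))
    have ht : t ∈ Set.Ioo (s - R) (s + R) := by
      have := abs_le.1 (le_refl |t - s|)
      constructor <;> linarith [this.1, this.2]
    have hsumt : Summable fun k => dysonTerm A s k t :=
      Summable.of_norm_bounded hsum fun k => hbd k t ht
    have hu : Summable u := (summable_nat_add_iff 1).1 (hsum.mul_left C)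
    have key := hasDerivAt_tsum_of_isPreconnected (g := fun k => dysonTerm A s k) (g' := g')
      hu isOpen_Ioo isPreconnected_Ioo ?_ ?_ ht hsumt ht
    · have hg : HasSum (fun k => g' (k + 1) t) (A t * ∑' k, dysonTerm A s k t) :=
        hsumt.hasSum.mul_left (A t)
      have hg2 := (hasSum_nat_add_iff (f := fun k => g' k t) 1).1 hg
      have hg3 : ∑' k, g' k t = A t * ∑' k, dysonTerm A s k t := by
        rw [hg2.tsum_eq]
        simp [g']
      rw [hg3] at key
      exact key
    · intro k y _
      cases k with
      | zero => exact hasDerivAt_const y (1 : E)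
      | succ k => exact dysonTerm_hasDerivAt A hA s k y
    · intro k y hy
      cases k with
      | zero => simp [g', u]
      | succ k =>
        exact (norm_mul_le _ _).trans
          (mul_le_mul (hCb y (Set.Ioo_subset_Icc_self hy)) (hbd k y hy) (norm_nonneg _) hC)

theorem dyson_unique {E : Type*} [NormedRing E] [NormedAlgebra ℝ E]
    (A : ℝ → E) (hA : Continuous A) (s : ℝ) (f g : ℝ → E) (hs : f s = g s)
    (hf : ∀ t, HasDerivAt f (A t * f t) t) (hg : ∀ t, HasDerivAt g (A t * g t) t) : f = g := by
  funext t
  set R : ℝ := |t - s| + 1 with hR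
  have hR0 : 0 < R := by positivity
  obtain ⟨C, hCb⟩ := (isCompact_Icc (a := s - R) (b := s + R)).exists_bound_of_continuousOn
    hA.continuousOn
  have hC : 0 ≤ C := (norm_nonneg _).trans (hCb s ⟨by linarith, by linarith⟩)
  have ht : t ∈ Set.Icc (s - R) (s + R) := by
    have := abs_le.1 (le_refl |t - s|)
    constructor <;> linarith [this.1, this.2]
  refine ODE_solution_unique_of_mem_Icc (v := fun t x => A t * x) (s := fun _ => Set.univ)
    (K := C.toNNReal) (t₀ := s) (a := s - R) (b := s + R) ?_ ⟨by linarith, by linarith⟩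
    (fun x _ => (hf x).continuousAt.continuousWithinAt) (fun x _ => hf x) (fun _ _ => trivial)
    (fun x _ => (hg x).continuousAt.continuousWithinAt) (fun x _ => hg x) (fun _ _ => trivial)
    hs ht
  intro y hy
  refine LipschitzWith.lipschitzOnWith (LipschitzWith.of_dist_le_mul fun a b => ?_)
  rw [dist_eq_norm, dist_eq_norm, ← mul_sub, Real.coe_toNNReal C hC]
  exact (norm_mul_le _ _).trans
    (mul_le_mul_of_nonneg_right (hCb y (Set.Ioo_subset_Icc_self hy)) (norm_nonneg _))


open Matrix

attribute [local instance] Matrix.linftyOpNormedAddCommGroup Matrix.linftyOpNormedRing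
  Matrix.linftyOpNormedAlgebra

/-- existence and uniqueness of the time-ordered evolution operator
`t ↦ U_{t,s}` as the solution of the linear initial-value problem
`Φ(s) = 1`, `Φ'(t) = −i H(t) Φ(t)`. -/
theorem propagator_exists_unique (n : ℕ) (hn : 1 ≤ n)
    (H : ℝ → Matrix (Fin n) (Fin n) ℂ) (hH : Continuous H) (s : ℝ) :
    ∃! Φ : ℝ → Matrix (Fin n) (Fin n) ℂ,
      Φ s = 1 ∧ ∀ t, HasDerivAt Φ ((-Complex.I) • (H t * Φ t)) t := by
  have hA : Continuous fun t => (-Complex.I) • H t := by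
    exact Continuous.const_smul hH (-Complex.I)
  obtain ⟨Φ, h0, h1⟩ := dyson_exists (fun t => (-Complex.I) • H t) hA s
  refine ⟨Φ, ⟨h0, fun t => ?_⟩, ?_⟩
  · have := h1 t
    rw [smul_mul_assoc] at this
    exact this
  · rintro Ψ ⟨k0, k1⟩
    refine dyson_unique (fun t => (-Complex.I) • H t) hA s Ψ Φ (k0.trans h0.symm) (fun t => ?_) h1
    rw [smul_mul_assoc]
    exact k1 t
end

section
/- Let n ≥ 1, let H : ℝ → Matrix (Fin n) (Fin n) ℂ be continuous with H(t)ᴴ = H(t) for all t (Hermitian-valued), fix s ∈ ℝ, and let Φ : ℝ → Matrix (Fin n) (Fin n) ℂ be differentiable with Φ(s) = 1 and Φ'(t) = −i • (H(t)·Φ(t)) for all t. Then Φ(t) is unitary for every t, i.e. Φ(t)ᴴ · Φ(t) = 1 and Φ(t) · Φ(t)ᴴ = 1 for all t ∈ ℝ. (Unitarity of the time-ordered evolution operator generated by a time-dependent Hermitian Hamiltonian.) -/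
open Matrix

attribute [local instance] Matrix.linftyOpNormedAddCommGroup Matrix.linftyOpNormedRing
  Matrix.linftyOpNormedAlgebra

/-- unitarity of the time-ordered evolution operator generated by a
time-dependent Hermitian Hamiltonian. -/
theorem propagator_unitary (n : ℕ) (hn : 1 ≤ n)
    (H : ℝ → Matrix (Fin n) (Fin n) ℂ) (hH : Continuous H)
    (hHerm : ∀ t, (H t)ᴴ = H t) (s : ℝ)
    (Φ : ℝ → Matrix (Fin n) (Fin n) ℂ)
    (hΦs : Φ s = 1)
    (hΦ : ∀ t, HasDerivAt Φ ((-Complex.I) • (H t * Φ t)) t) :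
    ∀ t, (Φ t)ᴴ * Φ t = 1 ∧ Φ t * (Φ t)ᴴ = 1 := by
  have hstar : ∀ t, HasDerivAt (fun t => (Φ t)ᴴ) (((-Complex.I) • (H t * Φ t))ᴴ) t := by
    intro t
    let L : Matrix (Fin n) (Fin n) ℂ →ₗ[ℝ] Matrix (Fin n) (Fin n) ℂ :=
      { toFun := fun A => Aᴴ
        map_add' := fun A B => Matrix.conjTranspose_add A B
        map_smul' := fun c A => by
          ext i j
          simp [Matrix.conjTranspose_apply] }
    exact (LinearMap.toContinuousLinearMap L).hasFDerivAt.comp_hasDerivAt t (hΦ t)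
  have hder : ∀ t, HasDerivAt (fun t => (Φ t)ᴴ * Φ t) 0 t := by
    intro t
    have h := (hstar t).mul (hΦ t)
    have h0 : ((-Complex.I) • (H t * Φ t))ᴴ * Φ t + (Φ t)ᴴ * ((-Complex.I) • (H t * Φ t)) = 0 := by
      simp [Matrix.conjTranspose_smul, Matrix.conjTranspose_mul, hHerm t, Matrix.mul_assoc]
    exact h0 ▸ h
  intro t
  have h1 : (Φ t)ᴴ * Φ t = 1 := by
    have h := is_const_of_deriv_eq_zero (f := fun t => (Φ t)ᴴ * Φ t)
      (fun x => (hder x).differentiableAt) (fun x => (hder x).deriv) t s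
    simpa [hΦs] using h
  exact ⟨h1, mul_eq_one_comm.mp h1⟩
end

section
/- Let n ≥ 1, let H : ℝ → Matrix (Fin n) (Fin n) ℂ be continuous, and let s, r ∈ ℝ. Suppose Φ, Ψ : ℝ → Matrix (Fin n) (Fin n) ℂ are differentiable with Φ(s) = 1, Φ'(t) = −i • (H(t)·Φ(t)) for all t, and Ψ(r) = 1, Ψ'(t) = −i • (H(t)·Ψ(t)) for all t. Then Φ(t) = Ψ(t) · Φ(r) for all t ∈ ℝ. (The composition law U_{t,s} = U_{t,r} U_{r,s} for the time-ordered evolution operator.) -/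
open Matrix

attribute [local instance] Matrix.linftyOpNormedAddCommGroup Matrix.linftyOpNormedRing
  Matrix.linftyOpNormedAlgebra

/-- Uniqueness for the linear ODE in a normed algebra, in composition form. -/
theorem propagator_comp_aux {A : Type*} [NormedRing A] [NormedAlgebra ℂ A]
    (H : ℝ → A) (hH : Continuous H) (r : ℝ) (Φ Ψ : ℝ → A)
    (hΦ : ∀ t, HasDerivAt Φ ((-Complex.I) • (H t * Φ t)) t)
    (hΨr : Ψ r = 1)
    (hΨ : ∀ t, HasDerivAt Ψ ((-Complex.I) • (H t * Ψ t)) t) :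
    ∀ t, Φ t = Ψ t * Φ r := by
  intro t
  obtain ⟨a, b, ht, hr⟩ : ∃ a b, t ∈ Set.Ioo a b ∧ r ∈ Set.Ioo a b :=
    ⟨min t r - 1, max t r + 1, by constructor <;> grind, by constructor <;> grind⟩
  obtain ⟨C, hC⟩ := (isCompact_Icc (a := a) (b := b)).exists_bound_of_continuousOn
    hH.continuousOn
  have hv : ∀ u ∈ Set.Ioo a b, LipschitzOnWith C.toNNReal
      ((fun (u : ℝ) (x : A) => (-Complex.I) • (H u * x)) u) ((fun _ => Set.univ) u) := by
    intro u hu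
    apply LipschitzOnWith.of_dist_le_mul
    intro x _ y _
    rw [dist_eq_norm, dist_eq_norm, ← smul_sub, ← mul_sub, norm_smul]
    simp only [norm_neg, Complex.norm_I, one_mul]
    refine (norm_mul_le _ _).trans ?_
    gcongr
    exact (hC u (Set.Ioo_subset_Icc_self hu)).trans (Real.le_coe_toNNReal C)
  refine ODE_solution_unique_of_mem_Ioo (g := fun t => Ψ t * Φ r) hv hr
    (fun u _ => ⟨hΦ u, trivial⟩) (fun u _ => ⟨?_, trivial⟩) (by simp [hΨr]) ht
  have h := (hΨ u).mul_const (Φ r)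
  simpa only [smul_mul_assoc, mul_assoc] using h

/-- the composition law `U_{t,s} = U_{t,r} U_{r,s}` for the
time-ordered evolution operator. -/
theorem propagator_comp (n : ℕ) (hn : 1 ≤ n)
    (H : ℝ → Matrix (Fin n) (Fin n) ℂ) (hH : Continuous H) (s r : ℝ)
    (Φ Ψ : ℝ → Matrix (Fin n) (Fin n) ℂ)
    (hΦs : Φ s = 1)
    (hΦ : ∀ t, HasDerivAt Φ ((-Complex.I) • (H t * Φ t)) t)
    (hΨr : Ψ r = 1)
    (hΨ : ∀ t, HasDerivAt Ψ ((-Complex.I) • (H t * Ψ t)) t) :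
    ∀ t, Φ t = Ψ t * Φ r := by
  exact propagator_comp_aux H hH r Φ Ψ hΦ hΨr hΨ
end

section
/- Let n ≥ 1, let H : ℝ → Matrix (Fin n) (Fin n) ℂ be continuous with H(t)ᴴ = H(t) for all t. For each a ∈ ℝ let Φ_a : ℝ → Matrix (Fin n) (Fin n) ℂ be differentiable with Φ_a(a) = 1 and Φ_a'(t) = −i • (H(t)·Φ_a(t)) for all t. Then for all s, t ∈ ℝ one has Φ_s(t)ᴴ = Φ_t(s). (The adjoint relation U_{t,s}† = U_{s,t} for the time-ordered evolution operator of a Hermitian time-dependent Hamiltonian.) -/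
open Matrix

attribute [local instance] Matrix.linftyOpNormedAddCommGroup Matrix.linftyOpNormedRing
  Matrix.linftyOpNormedAlgebra

/-- the adjoint relation `U_{t,s}† = U_{s,t}` for the time-ordered evolution
operator of a Hermitian time-dependent Hamiltonian. -/
theorem propagator_adjoint (n : ℕ) (hn : 1 ≤ n)
    (H : ℝ → Matrix (Fin n) (Fin n) ℂ) (hH : Continuous H)
    (hHerm : ∀ t, (H t)ᴴ = H t)
    (Φ : ℝ → ℝ → Matrix (Fin n) (Fin n) ℂ)
    (hΦ1 : ∀ a, Φ a a = 1)
    (hΦ : ∀ a t, HasDerivAt (Φ a) ((-Complex.I) • (H t * Φ a t)) t) :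
    ∀ s t, (Φ s t)ᴴ = Φ t s := by
  intro s t
  have : @ContinuousStar (Matrix (Fin n) (Fin n) ℂ)
      (Matrix.linftyOpNormedAddCommGroup.toMetricSpace.toPseudoMetricSpace.toUniformSpace.toTopologicalSpace) _ :=
    ⟨Continuous.matrix_conjTranspose continuous_id⟩
  have hstar : ∀ a r, HasDerivAt (fun r => (Φ a r)ᴴ) (((-Complex.I) • (H r * Φ a r))ᴴ) r :=
    fun a r => (hΦ a r).star
  have hd : ∀ r, HasDerivAt (fun r => (Φ s r)ᴴ * Φ t r) 0 r := by
    intro r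
    have h := (hstar s r).mul (hΦ t r)
    have e : ((-Complex.I) • (H r * Φ s r))ᴴ * Φ t r
        + (Φ s r)ᴴ * ((-Complex.I) • (H r * Φ t r)) = 0 := by
      simp [Matrix.conjTranspose_smul, Matrix.conjTranspose_mul, hHerm, Matrix.mul_assoc]
    rw [e] at h
    exact h
  have hc := is_const_of_deriv_eq_zero (fun r => (hd r).differentiableAt)
    (fun r => (hd r).deriv) t s
  simpa [hΦ1] using hc
end

section
/- Let n ≥ 1, let H : ℝ → Matrix (Fin n) (Fin n) ℂ be continuously differentiable with derivative H', let U be a propagator for H, let y₀ ∈ ℂⁿ, and fix t ∈ ℝ. Then the map s ↦ U(s, s−t)·y₀ is twice differentiable, and its second derivative at s = t equals −i • (H'(t)·y(t)) − (H(t)·(H(t)·y(t))) + 2 • (H(t)·(U(t,0)·(H(0)·y₀))) − U(t,0)·(H(0)·(H(0)·y₀)) + i • (U(t,0)·(H'(0)·y₀)), where y(t) := U(t,0)·y₀. -/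
open Matrix

attribute [local instance] Matrix.linftyOpNormedAddCommGroup Matrix.linftyOpNormedRing
  Matrix.linftyOpNormedAlgebra

theorem hasDerivAt_mulVec_aux {n : ℕ} (v : Fin n → ℂ) {A : ℝ → Matrix (Fin n) (Fin n) ℂ}
    {A' : Matrix (Fin n) (Fin n) ℂ} {s : ℝ} (h : HasDerivAt A A' s) :
    HasDerivAt (fun σ => (A σ).mulVec v) (A'.mulVec v) s := by
  let L : Matrix (Fin n) (Fin n) ℂ →ₗ[ℝ] (Fin n → ℂ) :=
    { toFun := fun M => M.mulVec v
      map_add' := fun M N => Matrix.add_mulVec M N v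
      map_smul' := fun c M => Matrix.smul_mulVec c M v }
  exact (LinearMap.toContinuousLinearMap L).hasFDerivAt.comp_hasDerivAt s h

/-- the second derivative of `s ↦ U(s,s−t) y₀` at `s = t`, for a continuously
differentiable time-dependent Hamiltonian. -/
theorem second_deriv_V (n : ℕ) (hn : 1 ≤ n)
    (H H' : ℝ → Matrix (Fin n) (Fin n) ℂ)
    (hH : ∀ t, HasDerivAt H (H' t) t) (hH' : Continuous H')
    (U : ℝ → ℝ → Matrix (Fin n) (Fin n) ℂ)
    (hU1 : ∀ t, U t t = 1)
    (hU2 : ∀ s t, HasDerivAt (fun τ => U τ s) ((-Complex.I) • (H t * U t s)) t)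
    (hU3 : ∀ t s, HasDerivAt (fun σ => U t σ) (Complex.I • (U t s * H s)) s)
    (hU4 : ∀ t r s, U t s = U t r * U r s)
    (y₀ : Fin n → ℂ) (t : ℝ)
    (y : ℝ → Fin n → ℂ) (hy : ∀ τ, y τ = (U τ 0).mulVec y₀) :
    ∃ V' : ℝ → Fin n → ℂ,
      (∀ s, HasDerivAt (fun σ => (U σ (σ - t)).mulVec y₀) (V' s) s) ∧
      HasDerivAt V'
        ((-Complex.I) • ((H' t).mulVec (y t))
          - (H t).mulVec ((H t).mulVec (y t))
          + (2 : ℂ) • ((H t).mulVec ((U t 0).mulVec ((H 0).mulVec y₀)))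
          - (U t 0).mulVec ((H 0).mulVec ((H 0).mulVec y₀))
          + Complex.I • ((U t 0).mulVec ((H' 0).mulVec y₀))) t := by
  have hW : ∀ s, HasDerivAt (fun σ => U σ (σ - t))
      ((-Complex.I) • (H s * U s (s - t)) + Complex.I • (U s (s - t) * H (s - t))) s := by
    intro s
    have h1 : HasDerivAt (fun σ => U 0 (σ - t)) (Complex.I • (U 0 (s - t) * H (s - t))) s := 
      HasDerivAt.comp_sub_const (f := fun σ => U 0 σ) s t (hU3 0 (s - t))
    have h2 := (hU2 0 s).mul h1
    have h3 : (fun σ => U σ (σ - t)) = (fun σ => U σ 0) * (fun σ => U 0 (σ - t)) := by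
      funext σ
      exact hU4 σ 0 (σ - t)
    rw [h3, hU4 s 0 (s - t)]
    refine h2.congr_deriv ?_
    simp [mul_assoc]
  have hHs : HasDerivAt (fun σ => H (σ - t)) (H' (t - t)) t := 
    HasDerivAt.comp_sub_const t t (hH (t - t))
  refine ⟨fun s => ((-Complex.I) • (H s * U s (s - t))
    + Complex.I • (U s (s - t) * H (s - t))).mulVec y₀,
    fun s => hasDerivAt_mulVec_aux y₀ (hW s), ?_⟩
  have hD := hasDerivAt_mulVec_aux y₀
    ((((hH t).mul (hW t)).const_smul (-Complex.I)).add
      (((hW t).mul hHs).const_smul Complex.I))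
  refine hD.congr_deriv ?_
  rw [hy]
  simp only [sub_self, Matrix.mulVec_mulVec, ← Matrix.smul_mulVec, ← Matrix.add_mulVec,
    ← Matrix.sub_mulVec]
  congr 1
  simp only [mul_add, add_mul, smul_add, mul_smul_comm, smul_mul_assoc, smul_smul, neg_mul,
    mul_neg, Complex.I_mul_I, neg_neg, neg_smul, smul_neg, one_smul, mul_assoc, two_smul]
  abel
end

section
/- Let n ≥ 1, let A : ℝ → Matrix (Fin n) (Fin n) ℂ be continuous, and let u : ℝ → ℂⁿ be differentiable with u'(t) = −i • (A(t)·u(t)) for all t. Define the Hermitian parts A₁(t) := (1/2) • (A(t) + A(t)ᴴ) and A₂(t) := (i/2) • (A(t) − A(t)ᴴ), so that A(t) = A₁(t) − i • A₂(t), and define the warped phase transformation v : ℝ × ℝ → ℂⁿ by v(t,ξ) := e^{−ξ} • u(t). Then for all t and all ξ ∈ ℝ, the partial derivatives exist and ∂v/∂t (t,ξ) = A₂(t) · (∂v/∂ξ (t,ξ)) − i • (A₁(t) · v(t,ξ)). (The Schrödingerisation warped-phase identity turning a general linear non-unitary system into a transport equation with Hermitian coefficient operators.) -/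
open Matrix

/-- the Schrödingerisation warped-phase identity: with
`A₁ = (A + Aᴴ)/2`, `A₂ = i(A − Aᴴ)/2` (so `A = A₁ − i A₂`) and `v(t,ξ) = e^{−ξ} u(t)`,
one has `∂v/∂t = A₂ ∂v/∂ξ − i A₁ v`. -/
theorem schrodingerisation_warped_phase (n : ℕ) (hn : 1 ≤ n)
    (A : ℝ → Matrix (Fin n) (Fin n) ℂ) (hA : Continuous A)
    (u : ℝ → Fin n → ℂ)
    (hu : ∀ t, HasDerivAt u ((-Complex.I) • ((A t).mulVec (u t))) t)
    (A₁ A₂ : ℝ → Matrix (Fin n) (Fin n) ℂ)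
    (hA₁ : ∀ t, A₁ t = ((1 : ℂ) / 2) • (A t + (A t)ᴴ))
    (hA₂ : ∀ t, A₂ t = (Complex.I / 2) • (A t - (A t)ᴴ))
    (v : ℝ → ℝ → Fin n → ℂ)
    (hv : ∀ t ξ, v t ξ = Real.exp (-ξ) • u t) :
    (∀ t, A t = A₁ t - Complex.I • A₂ t) ∧
      ∀ t ξ, ∃ vξ : Fin n → ℂ,
        HasDerivAt (fun ζ => v t ζ) vξ ξ ∧
        HasDerivAt (fun τ => v τ ξ)
          ((A₂ t).mulVec vξ - Complex.I • ((A₁ t).mulVec (v t ξ))) t := by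
  have hdec : ∀ t, A t = A₁ t - Complex.I • A₂ t := by
    intro t
    rw [hA₁, hA₂, smul_smul]
    have h : Complex.I * (Complex.I / 2) = -(1 / 2) := by
      rw [← mul_div_assoc, Complex.I_mul_I]; ring
    rw [h]
    ext i j
    simp only [Matrix.sub_apply, Matrix.smul_apply, Matrix.add_apply, smul_eq_mul]
    ring
  refine ⟨hdec, fun t ξ => ⟨-(Real.exp (-ξ) • u t), ?_, ?_⟩⟩
  · have h1 : HasDerivAt (fun ζ : ℝ => Real.exp (-ζ)) (-Real.exp (-ξ)) ξ := by
      simpa using (hasDerivAt_neg ξ).exp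
    have h2 := h1.smul_const (u t)
    simp only [hv]
    rw [← neg_smul]
    exact h2
  · have h2 := (hu t).const_smul (Real.exp (-ξ))
    simp only [hv]
    refine h2.congr_deriv ?_
    rw [hdec t, Matrix.sub_mulVec, Matrix.smul_mulVec, Matrix.mulVec_neg,
      Matrix.mulVec_smul, Matrix.mulVec_smul]
    ext i
    simp only [Pi.smul_apply, Pi.sub_apply, Pi.neg_apply, smul_eq_mul, Complex.real_smul]
    linear_combination (Real.exp (-ξ) : ℂ) * ((A₂ t).mulVec (u t) i) * Complex.I_mul_I
end
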